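/- Let {μ_n}_{n=1}^∞ and {ρ_n}_{n=1}^∞ be sequences of complex numbers with ∑|μ_n|² < ∞ and ∑|ρ_n| < ∞, and set z_n = n + μ_n + ρ_n. Then the sequences sup_{0≤ξ≤π} |sin(z_n ξ) − sin(nξ) − μ_n ξ cos(nξ)| and sup_{0≤ξ≤π} |cos(z_n ξ) − cos(nξ) + μ_n ξ sin(nξ)|, indexed by n, are both summable (belong to ℓ₁). -/

import Mathlib

open MeasureTheory Real Set Filter

noncomputable section

theorem norm_cos_sub_one_le {w : ℂ} (hw : ‖w‖ ≤ 1) : ‖Complex.cos w - 1‖ ≤ ‖w‖ ^ 2 := by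
  have h₁ := Complex.norm_exp_sub_one_sub_id_le (x := w * Complex.I) (by simpa using hw)
  have h₂ := Complex.norm_exp_sub_one_sub_id_le (x := -w * Complex.I) (by simpa using hw)
  have key : Complex.cos w - 1 = ((Complex.exp (w * Complex.I) - 1 - w * Complex.I) +
      (Complex.exp (-w * Complex.I) - 1 - -w * Complex.I)) / 2 := by
    rw [Complex.cos]; ring
  simp only [norm_mul, norm_neg, Complex.norm_I, mul_one] at h₁ h₂
  rw [key, norm_div, Complex.norm_ofNat]
  have := norm_add_le (Complex.exp (w * Complex.I) - 1 - w * Complex.I)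
    (Complex.exp (-w * Complex.I) - 1 - -w * Complex.I)
  linarith

theorem norm_sin_sub_self_le {w : ℂ} (hw : ‖w‖ ≤ 1) : ‖Complex.sin w - w‖ ≤ ‖w‖ ^ 2 := by
  have h₁ := Complex.norm_exp_sub_one_sub_id_le (x := w * Complex.I) (by simpa using hw)
  have h₂ := Complex.norm_exp_sub_one_sub_id_le (x := -w * Complex.I) (by simpa using hw)
  have key : Complex.sin w - w = ((Complex.exp (-w * Complex.I) - 1 - -w * Complex.I) -
      (Complex.exp (w * Complex.I) - 1 - w * Complex.I)) * Complex.I / 2 := by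
    rw [Complex.sin]; linear_combination -w * Complex.I_sq
  simp only [norm_mul, norm_neg, Complex.norm_I, mul_one] at h₁ h₂
  rw [key, norm_div, norm_mul, Complex.norm_I, mul_one, Complex.norm_ofNat]
  have := norm_sub_le (Complex.exp (-w * Complex.I) - 1 - -w * Complex.I)
    (Complex.exp (w * Complex.I) - 1 - w * Complex.I)
  linarith

theorem norm_sin_ofReal_le_one (a : ℝ) : ‖Complex.sin a‖ ≤ 1 := by
  rw [← Complex.ofReal_sin, Complex.norm_real]
  exact Real.abs_sin_le_one a

theorem norm_cos_ofReal_le_one (a : ℝ) : ‖Complex.cos a‖ ≤ 1 := by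
  rw [← Complex.ofReal_cos, Complex.norm_real]
  exact Real.abs_cos_le_one a

theorem norm_sin_add_sub_sub_le (a : ℝ) {u v : ℂ} (h : ‖u + v‖ ≤ 1) :
    ‖Complex.sin (a + (u + v)) - Complex.sin a - u * Complex.cos a‖
      ≤ 2 * ‖u + v‖ ^ 2 + ‖v‖ := by
  have key : Complex.sin (a + (u + v)) - Complex.sin a - u * Complex.cos a =
      Complex.sin a * (Complex.cos (u + v) - 1) +
        Complex.cos a * (Complex.sin (u + v) - (u + v)) + Complex.cos a * v := by
    rw [Complex.sin_add]; ring
  rw [key]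
  refine norm_add₃_le.trans ?_
  simp only [norm_mul]
  have h₁ := mul_le_mul (norm_sin_ofReal_le_one a) (norm_cos_sub_one_le h)
    (norm_nonneg _) zero_le_one
  have h₂ := mul_le_mul (norm_cos_ofReal_le_one a) (norm_sin_sub_self_le h)
    (norm_nonneg _) zero_le_one
  have h₃ := mul_le_mul_of_nonneg_right (norm_cos_ofReal_le_one a) (norm_nonneg v)
  linarith

theorem norm_cos_add_sub_add_le (a : ℝ) {u v : ℂ} (h : ‖u + v‖ ≤ 1) :
    ‖Complex.cos (a + (u + v)) - Complex.cos a + u * Complex.sin a‖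
      ≤ 2 * ‖u + v‖ ^ 2 + ‖v‖ := by
  have key : Complex.cos (a + (u + v)) - Complex.cos a + u * Complex.sin a =
      Complex.cos a * (Complex.cos (u + v) - 1) +
        -(Complex.sin a * (Complex.sin (u + v) - (u + v))) + -(Complex.sin a * v) := by
    rw [Complex.cos_add]; ring
  rw [key]
  refine norm_add₃_le.trans ?_
  simp only [norm_mul, norm_neg]
  have h₁ := mul_le_mul (norm_cos_ofReal_le_one a) (norm_cos_sub_one_le h)
    (norm_nonneg _) zero_le_one
  have h₂ := mul_le_mul (norm_sin_ofReal_le_one a) (norm_sin_sub_self_le h)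
    (norm_nonneg _) zero_le_one
  have h₃ := mul_le_mul_of_nonneg_right (norm_sin_ofReal_le_one a) (norm_nonneg v)
  linarith

/-- Summability of suprema over `[0, π]` of quantities with a quadratic remainder estimate in
`(μ n + ρ n) ξ` and a linear one in `ρ n ξ`. -/
theorem summable_iSup_of_norm_le {μ ρ : ℕ → ℂ}
    (hμ : Summable fun n => ‖μ n‖ ^ 2) (hρ : Summable fun n => ‖ρ n‖)
    (F : ℕ → ℝ → ℂ)
    (hF : ∀ (n : ℕ) (ξ : ℝ), ‖μ n * ξ + ρ n * ξ‖ ≤ 1 →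
      ‖F n ξ‖ ≤ 2 * ‖μ n * ξ + ρ n * ξ‖ ^ 2 + ‖ρ n * ξ‖) :
    Summable fun n : ℕ => ⨆ ξ : Set.Icc (0:ℝ) Real.pi, ‖F n ξ‖ := by
  refine Summable.of_norm_bounded_eventually_nat
    (g := fun n => 64 * ‖μ n‖ ^ 2 + 68 * ‖ρ n‖)
    ((hμ.mul_left _).add (hρ.mul_left _)) ?_
  filter_upwards [hμ.tendsto_atTop_zero.eventually_lt_const (show (0:ℝ) < (1 / 10) ^ 2 by norm_num),
    hρ.tendsto_atTop_zero.eventually_lt_const (show (0:ℝ) < 1 / 10 by norm_num)] with n hμn hρn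
  have hμ0 := norm_nonneg (μ n)
  have hρ0 := norm_nonneg (ρ n)
  have hμn' : ‖μ n‖ < 1 / 10 := lt_of_pow_lt_pow_left₀ 2 (by norm_num) hμn
  rw [Real.norm_of_nonneg (Real.iSup_nonneg fun _ => norm_nonneg _)]
  refine Real.iSup_le ?_ (by positivity)
  rintro ⟨ξ, hξ₀, hξ⟩
  have hξ4 : ξ ≤ 4 := hξ.trans Real.pi_le_four
  have hsum : ‖μ n * ξ + ρ n * ξ‖ ≤ 4 * (‖μ n‖ + ‖ρ n‖) := by
    rw [← add_mul, norm_mul, Complex.norm_of_nonneg hξ₀, mul_comm]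
    exact mul_le_mul hξ4 (norm_add_le _ _) (norm_nonneg _) (by norm_num)
  have hlin : ‖ρ n * ξ‖ ≤ 4 * ‖ρ n‖ := by
    rw [norm_mul, Complex.norm_of_nonneg hξ₀, mul_comm]
    exact mul_le_mul_of_nonneg_right hξ4 hρ0
  have hsq := pow_le_pow_left₀ (norm_nonneg _) hsum 2
  refine (hF n ξ (by linarith)).trans ?_
  nlinarith [sq_nonneg (‖μ n‖ - ‖ρ n‖)]

/-- If `∑|μ_n|² < ∞`, `∑|ρ_n| < ∞` and `z_n = n + μ_n + ρ_n`, then the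
sequences `sup_{0≤ξ≤π} |sin(z_n ξ) - sin(nξ) - μ_n ξ cos(nξ)|` and
`sup_{0≤ξ≤π} |cos(z_n ξ) - cos(nξ) + μ_n ξ sin(nξ)|` are summable. -/
theorem statement9 (μ ρ : ℕ → ℂ)
    (hμ : Summable fun n => ‖μ n‖ ^ 2) (hρ : Summable fun n => ‖ρ n‖)
    (z : ℕ → ℂ) (hz : ∀ n : ℕ, z n = n + μ n + ρ n) :
    Summable (fun n : ℕ => ⨆ ξ : Set.Icc (0:ℝ) Real.pi,
      ‖Complex.sin (z n * ξ) - Complex.sin (n * ξ) - μ n * ξ * Complex.cos (n * ξ)‖) ∧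
    Summable (fun n : ℕ => ⨆ ξ : Set.Icc (0:ℝ) Real.pi,
      ‖Complex.cos (z n * ξ) - Complex.cos (n * ξ) + μ n * ξ * Complex.sin (n * ξ)‖) := by
  have hzξ (n : ℕ) (ξ : ℝ) : z n * ξ = ((n * ξ : ℝ) : ℂ) + (μ n * ξ + ρ n * ξ) := by
    rw [hz]; push_cast; ring
  have hn (n : ℕ) (ξ : ℝ) : (n : ℂ) * ξ = ((n * ξ : ℝ) : ℂ) := by push_cast; rfl
  constructor
  · refine summable_iSup_of_norm_le hμ hρ (fun n ξ => Complex.sin (z n * ξ) -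
      Complex.sin (n * ξ) - μ n * ξ * Complex.cos (n * ξ)) fun n ξ h => ?_
    rw [hzξ, hn]
    exact norm_sin_add_sub_sub_le _ h
  · refine summable_iSup_of_norm_le hμ hρ (fun n ξ => Complex.cos (z n * ξ) -
      Complex.cos (n * ξ) + μ n * ξ * Complex.sin (n * ξ)) fun n ξ h => ?_
    rw [hzξ, hn]
    exact norm_cos_add_sub_add_le _ h
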